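/- arXiv:1601.05604 — 3 statements merged into one kernel-verified Lean document; each statement's English description precedes it below -/
import Mathlib

section
/- Let G be a connected graph with no isolated vertices whose adjacency matrix A has exactly two positive eigenvalues and all other eigenvalues equal to -2 or 0. Then no two columns of A + I are equal, and no two columns of A + I are almost equal (i.e., there are no two columns of A + I of different weights that differ in at most two positions). -/
open scoped Classical

/-- The adjacency spectrum (multiset of eigenvalues with multiplicity) of a graph. -/
noncomputable def adjSpectrum {V : Type*} [Fintype V] [DecidableEq V]
    (G : SimpleGraph V) : Multiset ℝ :=
  (SimpleGraph.adjMatrix ℝ G).charpoly.roots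

/-- A real symmetric matrix `A` with `x ^ 2 + 2 * x ≥ 0` for all its eigenvalues `x` has
positive semidefinite `(A + 1) ^ 2 - 1`. -/
theorem posSemidef_add_one_mul_self_sub_one {V : Type*} [Fintype V] [DecidableEq V]
    {A : Matrix V V ℝ} (hA : A.IsHermitian)
    (h : ∀ x ∈ A.charpoly.roots, 0 ≤ x ^ 2 + 2 * x) :
    ((A + 1) * (A + 1) - 1).PosSemidef := by
  set D : Matrix V V ℝ := Matrix.diagonal hA.eigenvalues with hD
  set U : Matrix V V ℝ := (hA.eigenvectorUnitary : Matrix V V ℝ) with hU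
  have hAU : A = U * D * star U := by
    simpa [Unitary.conjStarAlgAut_apply, Function.comp_def] using hA.spectral_theorem
  have hUU : star U * U = 1 := Unitary.coe_star_mul_self _
  have hEq : (A + 1) * (A + 1) - 1 = U * (D * D + 2 • D) * star U := by
    have hsq : A * A = U * (D * D) * star U := by
      calc A * A = U * D * (star U * U) * D * star U := by
            conv_lhs => rw [hAU]
            noncomm_ring
        _ = U * (D * D) * star U := by rw [hUU]; noncomm_ring
    have hexp : (A + 1) * (A + 1) - 1 = A * A + 2 • A := by noncomm_ring
    rw [hexp, hsq]
    conv_lhs => rw [hAU]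
    noncomm_ring
  rw [hEq, Matrix.star_eq_conjTranspose]
  refine Matrix.PosSemidef.mul_mul_conjTranspose_same ?_ U
  have hDD : D * D + 2 • D
      = Matrix.diagonal fun i => hA.eigenvalues i ^ 2 + 2 * hA.eigenvalues i := by
    rw [hD, Matrix.diagonal_mul_diagonal, ← Matrix.diagonal_smul, Matrix.diagonal_add]
    congr 1
    ext i
    simp [pow_two]
  rw [hDD, Matrix.posSemidef_diagonal_iff]
  intro i
  refine h _ ?_
  rw [hA.roots_charpoly_eq_eigenvalues]
  simp

/-- If `B` is symmetric and `B * B - 1` is positive semidefinite, then distinct columns of `B`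
are at squared distance at least `2`, with equality only if they have the same norm. -/
theorem two_le_sum_sq_sub_col {V : Type*} [Fintype V] [DecidableEq V]
    {B : Matrix V V ℝ} (hB : B.transpose = B) (h : (B * B - 1).PosSemidef)
    {j k : V} (hjk : j ≠ k) :
    2 ≤ ∑ i, (B i j - B i k) ^ 2 ∧
      (∑ i, (B i j - B i k) ^ 2 = 2 → ∑ i, B i j ^ 2 = ∑ i, B i k ^ 2) := by
  set x : V → ℝ := Pi.single j 1 - Pi.single k 1 with hx
  have hsymm (a b : V) : B a b = B b a := congrFun (congrFun hB.symm a) b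
  have hmul (a : V) : ((B * B - 1).mulVec x) a
      = ∑ i, B i a * (B i j - B i k) - x a := by
    rw [Matrix.sub_mulVec, Matrix.one_mulVec, ← Matrix.mulVec_mulVec, Pi.sub_apply]
    congr 1
    rw [hx, Matrix.mulVec_sub]
    simp [Matrix.mulVec, dotProduct, hsymm a]
  have hxj : x j = 1 := by simp [hx, hjk]
  have hxk : x k = -1 := by simp [hx, hjk]
  have hquad : star x ⬝ᵥ (B * B - 1).mulVec x = ∑ i, (B i j - B i k) ^ 2 - 2 := by
    have hdot (v : V → ℝ) : star x ⬝ᵥ v = v j - v k := by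
      simp [hx, sub_dotProduct]
    rw [hdot, hmul, hmul, hxj, hxk]
    have : ∑ i, (B i j - B i k) ^ 2
        = ∑ i, B i j * (B i j - B i k) - ∑ i, B i k * (B i j - B i k) := by
      rw [← Finset.sum_sub_distrib]
      exact Finset.sum_congr rfl fun i _ => by ring
    rw [this]
    ring
  refine ⟨?_, fun h2 => ?_⟩
  · have := h.dotProduct_mulVec_nonneg x
    linarith
  · have hzero := (h.dotProduct_mulVec_zero_iff x).1 (by rw [hquad, h2, sub_self])
    have h₁ := hmul j
    have h₂ := hmul k
    rw [hzero, Pi.zero_apply, hxj] at h₁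
    rw [hzero, Pi.zero_apply, hxk] at h₂
    have : ∑ i, B i j ^ 2 - ∑ i, B i k ^ 2
        = ∑ i, B i j * (B i j - B i k) + ∑ i, B i k * (B i j - B i k) := by
      rw [← Finset.sum_sub_distrib, ← Finset.sum_add_distrib]
      exact Finset.sum_congr rfl fun i _ => by ring
    linarith

theorem adjMatrix_add_one_apply_eq_zero_or_one {V : Type*} [DecidableEq V]
    (G : SimpleGraph V) (i j : V) :
    (G.adjMatrix ℝ + 1) i j = 0 ∨ (G.adjMatrix ℝ + 1) i j = 1 := by
  rcases eq_or_ne i j with rfl | hij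
  · simp
  · by_cases hG : G.Adj i j <;> simp [hij, hG]

/-- If `G` is a connected graph with no isolated vertices whose adjacency matrix
`A` has exactly two positive eigenvalues and all other eigenvalues equal to `-2`
or `0`, then no two columns of `A + I` are equal, and no two columns of `A + I`
are almost equal (i.e. there are no two columns with different weights
(= column sums, the numbers of ones) differing in at most two positions). -/
theorem no_two_columns_almost_equal {V : Type*} [Fintype V] [DecidableEq V]
    (G : SimpleGraph V)
    (h_conn : G.Connected)
    (h_no_isolated : ∀ v : V, ∃ w : V, G.Adj v w)
    (h_two_pos : ((adjSpectrum G).filter (fun x => 0 < x)).card = 2)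
    (h_rest : ∀ x ∈ adjSpectrum G, 0 < x ∨ x = -2 ∨ x = 0) :
    ∀ j j' : V, j ≠ j' →
      ((fun i => (SimpleGraph.adjMatrix ℝ G + 1) i j) ≠
        (fun i => (SimpleGraph.adjMatrix ℝ G + 1) i j')) ∧
      ¬ ((∑ i, (SimpleGraph.adjMatrix ℝ G + 1) i j ≠
            ∑ i, (SimpleGraph.adjMatrix ℝ G + 1) i j') ∧
          (Finset.univ.filter (fun i => (SimpleGraph.adjMatrix ℝ G + 1) i j ≠
            (SimpleGraph.adjMatrix ℝ G + 1) i j')).card ≤ 2) := by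
  intro j j' hjj'
  set B := SimpleGraph.adjMatrix ℝ G + 1 with hB
  have h01 (a b : V) : B a b = 0 ∨ B a b = 1 := adjMatrix_add_one_apply_eq_zero_or_one G a b
  have hpsd : (B * B - 1).PosSemidef := by
    refine posSemidef_add_one_mul_self_sub_one (SimpleGraph.isHermitian_adjMatrix ℝ G) fun x hx => ?_
    rcases h_rest x hx with h | rfl | rfl
    · positivity
    · norm_num
    · norm_num
  obtain ⟨hle, heq⟩ := two_le_sum_sq_sub_col (by simp [hB]) hpsd hjj'
  refine ⟨fun hcol => ?_, fun ⟨hweight, hcard⟩ => hweight ?_⟩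
  · have hzero : ∑ i, (B i j - B i j') ^ 2 = 0 :=
      Finset.sum_eq_zero fun i _ => by rw [congrFun hcol i]; ring
    linarith
  · have hdist : ∑ i, (B i j - B i j') ^ 2
        = (Finset.univ.filter fun i => B i j ≠ B i j').card := by
      rw [Finset.card_filter, Nat.cast_sum]
      refine Finset.sum_congr rfl fun i _ => ?_
      rcases h01 i j with h | h <;> rcases h01 i j' with h' | h' <;> simp [h, h']
    have hcard' : ((Finset.univ.filter fun i => B i j ≠ B i j').card : ℝ) ≤ 2 := by
      exact_mod_cast hcard
    have hsq (a b : V) : B a b ^ 2 = B a b := by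
      rcases h01 a b with h | h <;> simp [h]
    simpa only [hsq] using heq (le_antisymm (hdist.trans_le hcard') hle)
end

section
/- The 9-vertex graph G_11 with edge set {{1,6},{1,7},{2,6},{2,7},{3,8},{3,9},{4,8},{4,9},{5,6},{5,7},{5,8},{5,9},{6,7},{6,9},{7,8},{8,9}} has adjacency spectrum {-2 with multiplicity 3, 0 with multiplicity 4, 2 with multiplicity 1, 4 with multiplicity 1}. -/
open scoped Classical

/-- The graph `G₁₁` on `9` vertices with edges (vertices labelled `1,…,9`)
`{1,6},{1,7},{2,6},{2,7},{3,8},{3,9},{4,8},{4,9},{5,6},{5,7},{5,8},{5,9},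
{6,7},{6,9},{7,8},{8,9}`. -/
def G11 : SimpleGraph (Fin 9) :=
  SimpleGraph.fromRel (fun u v => ((u : ℕ) + 1, (v : ℕ) + 1) ∈
    [(1,6),(1,7),(2,6),(2,7),(3,8),(3,9),(4,8),(4,9),(5,6),(5,7),(5,8),(5,9),
     (6,7),(6,9),(7,8),(8,9)])

open Polynomial in
/-- A square matrix over a field with an eigenbasis, given by the columns of `P`, has the
characteristic polynomial of the diagonal matrix of its eigenvalues. -/
theorem Matrix.charpoly_eq_prod_of_mul_eq_mul_diagonal {n K : Type*} [Fintype n] [DecidableEq n]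
    [Field K] {A P Q : Matrix n n K} {d : n → K} {c : K} (hc : c ≠ 0)
    (hAP : A * P = P * Matrix.diagonal d) (hQP : Q * P = c • (1 : Matrix n n K)) :
    A.charpoly = ∏ i, (X - C (d i)) := by
  have hinv : (c⁻¹ • Q) * P = 1 := by
    rw [Matrix.smul_mul, hQP, smul_smul, inv_mul_cancel₀ hc, one_smul]
  have hA : A = P * Matrix.diagonal d * (c⁻¹ • Q) := by
    rw [← hAP, Matrix.mul_assoc, mul_eq_one_comm.mp hinv, Matrix.mul_one]
  rw [hA, Matrix.charpoly_mul_comm, ← Matrix.mul_assoc, hinv, Matrix.one_mul,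
    Matrix.charpoly_diagonal]

/-- The adjacency matrix of `G11` with integer entries. -/
def G11IntMatrix : Matrix (Fin 9) (Fin 9) ℤ :=
  !![0, 0, 0, 0, 0, 1, 1, 0, 0;
    0, 0, 0, 0, 0, 1, 1, 0, 0;
    0, 0, 0, 0, 0, 0, 0, 1, 1;
    0, 0, 0, 0, 0, 0, 0, 1, 1;
    0, 0, 0, 0, 0, 1, 1, 1, 1;
    1, 1, 0, 0, 1, 0, 1, 0, 1;
    1, 1, 0, 0, 1, 1, 0, 1, 0;
    0, 0, 1, 1, 1, 0, 1, 0, 1;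
    0, 0, 1, 1, 1, 1, 0, 1, 0]

/-- The eigenvalues of `G11`, in the order of the columns of `G11Eigenvectors`. -/
def G11Eigenvalues : Fin 9 → ℤ := ![-2, -2, -2, 0, 0, 0, 0, 2, 4]

/-- A matrix whose columns are a basis of eigenvectors of `G11IntMatrix`. -/
def G11Eigenvectors : Matrix (Fin 9) (Fin 9) ℤ :=
  !![-1, -1, 1, -1, 0, -1, 0, -1, 1;
    -1, -1, 1, 1, 0, 0, 0, -1, 1;
    0, -1, -1, 0, -1, -1, 0, 1, 1;
    0, -1, -1, 0, 1, 0, 0, 1, 1;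
    -1, -2, 0, 0, 0, 1, 0, 0, 2;
    1, 2, -2, 0, 0, 0, 1, -1, 2;
    1, 0, 0, 0, 0, 0, -1, -1, 2;
    0, 2, 0, 0, 0, 0, -1, 1, 2;
    0, 0, 2, 0, 0, 0, 1, 1, 2]

/-- `48` times the inverse of `G11Eigenvectors`. -/
def G11EigenvectorsScaledInv : Matrix (Fin 9) (Fin 9) ℤ :=
  !![-10, -10, 2, 2, -8, -2, 22, -14, 10;
    1, 1, -5, -5, -4, 5, -7, 11, -1;
    1, 1, -5, -5, -4, -7, 5, -1, 11;
    -18, 30, 6, 6, -12, 0, 0, 0, 0;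
    6, 6, -18, 30, -12, 0, 0, 0, 0;
    -12, -12, -12, -12, 24, 0, 0, 0, 0;
    0, 0, 0, 0, 0, 12, -12, -12, 12;
    -6, -6, 6, 6, 0, -6, -6, 6, 6;
    2, 2, 2, 2, 4, 4, 4, 4, 4]

theorem G11IntMatrix_mul_eigenvectors :
    G11IntMatrix * G11Eigenvectors = G11Eigenvectors * Matrix.diagonal G11Eigenvalues := by
  decide +kernel

theorem G11EigenvectorsScaledInv_mul :
    G11EigenvectorsScaledInv * G11Eigenvectors = (48 : ℤ) • (1 : Matrix (Fin 9) (Fin 9) ℤ) := by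
  decide +kernel

theorem adjMatrix_G11 :
    G11.adjMatrix ℝ = G11IntMatrix.map (Int.castRingHom ℝ) := by
  ext i j
  rw [SimpleGraph.adjMatrix_apply]
  fin_cases i <;> fin_cases j <;> simp [G11, G11IntMatrix]

theorem charpoly_adjMatrix_G11 :
    (G11.adjMatrix ℝ).charpoly =
      ∏ i, (Polynomial.X - Polynomial.C (G11Eigenvalues i : ℝ)) := by
  rw [adjMatrix_G11]
  refine Matrix.charpoly_eq_prod_of_mul_eq_mul_diagonal
    (P := G11Eigenvectors.map (Int.castRingHom ℝ))
    (Q := G11EigenvectorsScaledInv.map (Int.castRingHom ℝ)) (c := 48) (by norm_num) ?_ ?_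
  · rw [← Matrix.map_mul, G11IntMatrix_mul_eigenvectors, Matrix.map_mul,
      Matrix.diagonal_map (map_zero _)]
    rfl
  · rw [← Matrix.map_mul, G11EigenvectorsScaledInv_mul]
    ext i j
    rw [Matrix.map_apply, Matrix.smul_apply, Matrix.smul_apply, Matrix.one_apply, Matrix.one_apply]
    split_ifs <;> simp

/-- The graph `G₁₁` has adjacency spectrum `{-2³, 0⁴, 2, 4}`. -/
theorem G11_spectrum :
    adjSpectrum G11 =
      Multiset.replicate 3 (-2 : ℝ) + Multiset.replicate 4 (0 : ℝ) +
        {(2 : ℝ), (4 : ℝ)} := by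
  have hprod : (∏ i, (Polynomial.X - Polynomial.C (G11Eigenvalues i : ℝ))).roots =
      Finset.univ.val.map fun i => (G11Eigenvalues i : ℝ) := by
    simpa [Finset.prod] using Polynomial.roots_multiset_prod_X_sub_C
      (Finset.univ.val.map fun i => (G11Eigenvalues i : ℝ))
  have hvalues : Finset.univ.val.map G11Eigenvalues =
      Multiset.replicate 3 (-2) + Multiset.replicate 4 0 + {2, 4} := by
    decide +kernel
  have hcast := congrArg (Multiset.map (Int.cast : ℤ → ℝ)) hvalues
  rw [Multiset.map_map] at hcast
  unfold adjSpectrum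
  rw [charpoly_adjMatrix_G11, hprod]
  simpa [Function.comp_def] using hcast
end

section
/- Let G be a graph whose adjacency matrix A has exactly two positive eigenvalues, and suppose A, after a suitable ordering of the vertices, has the block form [[O, N],[N^T, B]] where the zero block O corresponds to an independent set of G. Then the 0-1 matrix N has rank at most 2. -/
open scoped Classical

namespace Matrix

/-- A real symmetric matrix annihilates every isotropic vector that is orthogonal to all
eigenvectors with positive eigenvalue. -/
theorem IsHermitian.mulVec_eq_zero_of_isotropic {n : Type*} [Fintype n] [DecidableEq n]
    {A : Matrix n n ℝ} (hA : A.IsHermitian) {v : n → ℝ} (hv : v ⬝ᵥ A *ᵥ v = 0)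
    (hpos : ∀ i, 0 < hA.eigenvalues i →
      ((hA.eigenvectorUnitary : Matrix n n ℝ)ᵀ *ᵥ v) i = 0) :
    A *ᵥ v = 0 := by
  set U : Matrix n n ℝ := (hA.eigenvectorUnitary).val
  have hAU : A = U * diagonal hA.eigenvalues * Uᵀ := by
    have h := hA.spectral_theorem
    rw [Unitary.conjStarAlgAut_apply] at h
    simpa [star_eq_conjTranspose, Function.comp_def] using h
  have hAv : A *ᵥ v = U *ᵥ (diagonal hA.eigenvalues *ᵥ (Uᵀ *ᵥ v)) := by
    conv_lhs => rw [hAU]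
    simp only [mulVec_mulVec, Matrix.mul_assoc]
  have hsum : ∑ i, (Uᵀ *ᵥ v) i * (hA.eigenvalues i * (Uᵀ *ᵥ v) i) = 0 := by
    rw [hAv, dotProduct_mulVec, ← mulVec_transpose] at hv
    simpa only [dotProduct, mulVec_diagonal] using hv
  have hnonpos : ∀ i ∈ Finset.univ,
      (Uᵀ *ᵥ v) i * (hA.eigenvalues i * (Uᵀ *ᵥ v) i) ≤ 0 := by
    intro i _
    rcases lt_or_ge 0 (hA.eigenvalues i) with h | h
    · simp [hpos i h]
    · nlinarith [sq_nonneg ((Uᵀ *ᵥ v) i)]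
  have hzero : diagonal hA.eigenvalues *ᵥ (Uᵀ *ᵥ v) = 0 := by
    ext i
    have h := (Finset.sum_eq_zero_iff_of_nonpos hnonpos).1 hsum i (Finset.mem_univ i)
    rw [mulVec_diagonal, Pi.zero_apply]
    rcases mul_eq_zero.1 h with h | h
    · rw [h, mul_zero]
    · exact h
  rw [hAv, hzero, mulVec_zero]

theorem rank_le_rank_of_ker_le {K l m n : Type*} [Field K] [Fintype n]
    {M : Matrix l n K} {N : Matrix m n K} (h : ∀ x, M *ᵥ x = 0 → N *ᵥ x = 0) :
    N.rank ≤ M.rank := by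
  have hker : LinearMap.ker M.mulVecLin ≤ LinearMap.ker N.mulVecLin := fun x hx => h x hx
  have hM := M.mulVecLin.finrank_range_add_finrank_ker
  have hN := N.mulVecLin.finrank_range_add_finrank_ker
  have := Submodule.finrank_mono hker
  unfold rank
  omega

theorem IsHermitian.card_filter_pos_roots_charpoly {n : Type*} [Fintype n] [DecidableEq n]
    {A : Matrix n n ℝ} (hA : A.IsHermitian) :
    (A.charpoly.roots.filter (fun x => 0 < x)).card =
      Fintype.card {i // 0 < hA.eigenvalues i} := by
  rw [hA.roots_charpoly_eq_eigenvalues, Multiset.filter_map, Multiset.card_map,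
    Fintype.card_subtype]
  rfl

/-- If a real symmetric matrix has a zero diagonal block, the rank of the adjacent off-diagonal
block is at most the number of positive eigenvalues. -/
theorem IsHermitian.rank_toBlocks₁₂_le {α β : Type*} [Fintype α] [Fintype β]
    [DecidableEq α] [DecidableEq β] {A : Matrix (α ⊕ β) (α ⊕ β) ℝ} (hA : A.IsHermitian)
    (h₁₁ : A.toBlocks₁₁ = 0) :
    A.toBlocks₁₂.rank ≤ (A.charpoly.roots.filter (fun x => 0 < x)).card := by
  let U : Matrix (α ⊕ β) (α ⊕ β) ℝ := hA.eigenvectorUnitary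
  let M : Matrix {i // 0 < hA.eigenvalues i} α ℝ := Uᵀ.submatrix Subtype.val Sum.inl
  have h₂₁ : A.toBlocks₁₂ᵀ = A.toBlocks₂₁ := by
    ext b a
    simpa [toBlocks₁₂, toBlocks₂₁] using hA.apply (Sum.inr b) (Sum.inl a)
  rw [hA.card_filter_pos_roots_charpoly, ← rank_transpose, h₂₁]
  refine (rank_le_rank_of_ker_le (M := M) fun x hx => ?_).trans M.rank_le_card_height
  have hAx : A *ᵥ Sum.elim x 0 = Sum.elim (0 : α → ℝ) (A.toBlocks₂₁ *ᵥ x) := by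
    rw [← fromBlocks_toBlocks A, fromBlocks_mulVec, h₁₁]
    simp
  have hzero : A *ᵥ Sum.elim x 0 = 0 := by
    refine hA.mulVec_eq_zero_of_isotropic ?_ fun i hi => ?_
    · rw [hAx]
      simp [dotProduct]
    · have h := congrFun hx ⟨i, hi⟩
      simpa [M, U, mulVec, dotProduct] using h
  ext b
  simpa using congrFun (hAx.symm.trans hzero) (Sum.inr b)

end Matrix

/-- Let `G` be a graph whose adjacency matrix `A` has exactly two positive
eigenvalues, and suppose (after a suitable ordering of the vertices, here
realised by taking the vertex set to be a sum type `α ⊕ β`) `A` has the block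
form `[[O, N], [Nᵀ, B]]`, where the zero block `O` corresponds to an independent
set of `G` (the vertices in `α`).  Then the 0-1 matrix `N` has rank at most `2`. -/
theorem rank_N_le_two {α β : Type*} [Fintype α] [Fintype β] [DecidableEq α] [DecidableEq β]
    (G : SimpleGraph (α ⊕ β))
    (h_indep : ∀ a a' : α, ¬ G.Adj (Sum.inl a) (Sum.inl a'))
    (h_two_pos : (((SimpleGraph.adjMatrix ℝ G).charpoly.roots).filter
      (fun x => 0 < x)).card = 2) :
    (Matrix.of fun (a : α) (b : β) =>
      SimpleGraph.adjMatrix ℝ G (Sum.inl a) (Sum.inr b)).rank ≤ 2 := by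
  rw [← h_two_pos]
  have hA : (G.adjMatrix ℝ).IsHermitian := by
    rw [Matrix.IsHermitian, Matrix.conjTranspose_eq_transpose_of_trivial]
    exact G.isSymm_adjMatrix
  have h₁₁ : (G.adjMatrix ℝ).toBlocks₁₁ = 0 := by
    ext a a'
    simp [Matrix.toBlocks₁₁, h_indep]
  exact hA.rank_toBlocks₁₂_le h₁₁
end
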